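/- arXiv:1509.03815 — 2 statements merged into one kernel-verified Lean document; each statement's English description precedes it below -/
import Mathlib

section
/- Let n ≥ 7 and let k be the maximum integer such that n = 4k+3+y with y ≥ 0. For every D ≥ 2k+3, there exists an n-vertex graph of diameter at most 2k+4 (namely 𝒢_k with y additional vertices adjacent only to R) on which there is a sequence of configurations γ_0 ↦ γ_1 ↦ … ↦ γ_m of Algo_B(D) with m ≥ (2k+2)(2^k − 1); the same holds for Algo_FHC(D). Hence the stabilization times in steps of Algo_B(D) and Algo_FHC(D) are at least (2k+2)(2^k−1) in the worst case. -/
open SimpleGraph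

/-- A configuration: a distance value `d` and a parent pointer `par` per vertex. -/
structure Config (V : Type*) where
  d : V → ℕ
  par : V → V

/-- `Min_d(p)`: the minimum of the `d`-values of the neighbors of `p`. -/
noncomputable def minD {V : Type*} (G : SimpleGraph V) (γ : Config V) (p : V) : ℕ :=
  sInf (γ.d '' {q | G.Adj p q})

def dOk {V : Type*} (G : SimpleGraph V) (γ : Config V) (p : V) : Prop :=
  γ.d p = minD G γ p + 1

def parOk {V : Type*} (γ : Config V) (p : V) : Prop :=
  γ.d p = γ.d (γ.par p) + 1

/-- A valid configuration of `Algo_U`: `d r = 0` and parent pointers are neighbors. -/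
def ValidU {V : Type*} (G : SimpleGraph V) (r : V) (γ : Config V) : Prop :=
  γ.d r = 0 ∧ ∀ p, p ≠ r → G.Adj p (γ.par p)

/-- A valid configuration of the bounded algorithms: non-root `d`-values in `{1,…,D}`. -/
def ValidB {V : Type*} (G : SimpleGraph V) (r : V) (D : ℕ) (γ : Config V) : Prop :=
  γ.d r = 0 ∧ ∀ p, p ≠ r → G.Adj p (γ.par p) ∧ 1 ≤ γ.d p ∧ γ.d p ≤ D

/-- Vertex `p` executes rule `U1` or `U2` in the step from `γ` to `γ'`:
`U1 : ¬dOk(p) → update(p)`, `U2 : dOk(p) ∧ ¬parOk(p) → par_p ← bestParent(p)`. -/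
def execU {V : Type*} (G : SimpleGraph V) (γ γ' : Config V) (p : V) : Prop :=
  (¬ dOk G γ p ∧ γ'.d p = minD G γ p + 1 ∧
    G.Adj p (γ'.par p) ∧ γ.d (γ'.par p) = minD G γ p) ∨
  (dOk G γ p ∧ ¬ parOk γ p ∧ γ'.d p = γ.d p ∧
    G.Adj p (γ'.par p) ∧ γ.d (γ'.par p) = minD G γ p)

/-- Vertex `p` executes one of the rules `B1`, `B2`, `B3` of `Algo_B(D)`. -/
def execB {V : Type*} (G : SimpleGraph V) (D : ℕ) (γ γ' : Config V) (p : V) : Prop :=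
  (minD G γ p < D ∧ ¬ dOk G γ p ∧ γ'.d p = minD G γ p + 1 ∧
    G.Adj p (γ'.par p) ∧ γ.d (γ'.par p) = minD G γ p) ∨
  (minD G γ p < D ∧ dOk G γ p ∧ ¬ parOk γ p ∧ γ'.d p = γ.d p ∧
    G.Adj p (γ'.par p) ∧ γ.d (γ'.par p) = minD G γ p) ∨
  (minD G γ p = D ∧ γ.d p ≠ D ∧ γ'.d p = D ∧ γ'.par p = γ.par p)

/-- Vertex `p` executes rule `HC1` or `HC2` of `Algo_HC(D)`. -/
def execHC {V : Type*} (G : SimpleGraph V) (D : ℕ) (γ γ' : Config V) (p : V) : Prop :=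
  (¬ parOk γ p ∧ γ.d (γ.par p) < D ∧ γ'.d p = γ.d (γ.par p) + 1 ∧ γ'.par p = γ.par p) ∨
  (minD G γ p < γ.d (γ.par p) ∧ γ'.d p = minD G γ p + 1 ∧
    G.Adj p (γ'.par p) ∧ γ.d (γ'.par p) = minD G γ p)

/-- Vertex `p` executes rule `HC2`: `d_{par_p} > Min_d(p) → update(p)`. -/
def execHC2 {V : Type*} (G : SimpleGraph V) (γ γ' : Config V) (p : V) : Prop :=
  minD G γ p < γ.d (γ.par p) ∧ γ'.d p = minD G γ p + 1 ∧
    G.Adj p (γ'.par p) ∧ γ.d (γ'.par p) = minD G γ p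

/-- Vertex `p` executes rule `FHC1` or `HC2` of `Algo_FHC(D)`. -/
def execFHC {V : Type*} (G : SimpleGraph V) (D : ℕ) (γ γ' : Config V) (p : V) : Prop :=
  (¬ parOk γ p ∧ γ.d (γ.par p) < D ∧ γ.d (γ.par p) = minD G γ p ∧
    γ'.d p = γ.d (γ.par p) + 1 ∧ γ'.par p = γ.par p) ∨
  execHC2 G γ γ' p

/-- A step of a distributed unfair daemon: a nonempty set `S` of (non-root) vertices,
each executing one of its enabled rules (as described by `exec`), all other vertices
keeping their state. -/
def StepWith {V : Type*} (r : V) (exec : Config V → Config V → V → Prop)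
    (γ γ' : Config V) (S : Set V) : Prop :=
  S.Nonempty ∧ (∀ p ∈ S, p ≠ r ∧ exec γ γ' p) ∧
    ∀ p ∉ S, γ'.d p = γ.d p ∧ γ'.par p = γ.par p

def Step {V : Type*} (r : V) (exec : Config V → Config V → V → Prop)
    (γ γ' : Config V) : Prop :=
  ∃ S : Set V, StepWith r exec γ γ' S

/-- Guard of the rules of `Algo_U` at `p`. -/
def guardU {V : Type*} (G : SimpleGraph V) (γ : Config V) (p : V) : Prop :=
  ¬ dOk G γ p ∨ (dOk G γ p ∧ ¬ parOk γ p)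

/-- Guard of the rules of `Algo_B(D)` at `p`. -/
def guardB {V : Type*} (G : SimpleGraph V) (D : ℕ) (γ : Config V) (p : V) : Prop :=
  (minD G γ p < D ∧ ¬ dOk G γ p) ∨
  (minD G γ p < D ∧ dOk G γ p ∧ ¬ parOk γ p) ∨
  (minD G γ p = D ∧ γ.d p ≠ D)

/-- Guard of the rules of `Algo_HC(D)` at `p`. -/
def guardHC {V : Type*} (G : SimpleGraph V) (D : ℕ) (γ : Config V) (p : V) : Prop :=
  (¬ parOk γ p ∧ γ.d (γ.par p) < D) ∨ minD G γ p < γ.d (γ.par p)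

/-- Guard of the rules of `Algo_FHC(D)` at `p`. -/
def guardFHC {V : Type*} (G : SimpleGraph V) (D : ℕ) (γ : Config V) (p : V) : Prop :=
  (¬ parOk γ p ∧ γ.d (γ.par p) < D ∧ γ.d (γ.par p) = minD G γ p) ∨
  minD G γ p < γ.d (γ.par p)

/-- A vertex is enabled when it is not the root and one of its guards holds. -/
def Enabled {V : Type*} (r : V) (guard : Config V → V → Prop) (γ : Config V) (p : V) : Prop :=
  p ≠ r ∧ guard γ p

/-- A terminal configuration: no vertex is enabled. -/
def Terminal {V : Type*} (r : V) (guard : Config V → V → Prop) (γ : Config V) : Prop :=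
  ∀ p, ¬ Enabled r guard γ p

/-- An execution (padded by stuttering once a terminal configuration is reached, so
that maximality is automatic): `e i` is the `i`-th configuration and `M i` the set of
vertices selected by the daemon at step `i`. -/
def IsExec {V : Type*} (r : V) (valid : Config V → Prop)
    (exec : Config V → Config V → V → Prop) (guard : Config V → V → Prop)
    (e : ℕ → Config V) (M : ℕ → Set V) : Prop :=
  (∀ i, valid (e i)) ∧
    ∀ i, (Terminal r guard (e i) ∧ e (i + 1) = e i ∧ M i = ∅) ∨
      StepWith r exec (e i) (e (i + 1)) (M i)

/-- Every vertex enabled in `e s` executes a rule or becomes neutralized in some step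
`j` with `s ≤ j < t`. -/
def Covers {V : Type*} (r : V) (guard : Config V → V → Prop)
    (e : ℕ → Config V) (M : ℕ → Set V) (s t : ℕ) : Prop :=
  ∀ p, Enabled r guard (e s) p →
    ∃ j, s ≤ j ∧ j < t ∧
      (p ∈ M j ∨ (Enabled r guard (e j) p ∧ ¬ Enabled r guard (e (j + 1)) p))

/-- `t` is the end of the round of execution `(e, M)` starting at index `s`:
the prefix from `s` to `t` is the minimal one in which every vertex enabled at `e s`
executes a rule or is neutralized. -/
def RoundEnd {V : Type*} (r : V) (guard : Config V → V → Prop)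
    (e : ℕ → Config V) (M : ℕ → Set V) (s t : ℕ) : Prop :=
  s ≤ t ∧ Covers r guard e M s t ∧ ∀ u, s ≤ u → Covers r guard e M s u → t ≤ u

/-- The vertices of the graph `𝒢_k`: `R`, `h.0`, `f.0`, and `e.j`, `f.j`, `g.j`, `h.j`
for `1 ≤ j ≤ k` (index `j : Fin k` encodes `j+1`). -/
inductive GVert (k : ℕ) where
  | R : GVert k
  | h0 : GVert k
  | f0 : GVert k
  | e : Fin k → GVert k
  | f : Fin k → GVert k
  | g : Fin k → GVert k
  | h : Fin k → GVert k
  deriving DecidableEq, Fintype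

/-- The base edges of `𝒢_k`: `{R,h.0}`, `{h.0,f.0}`, `{f.0,e.1}`, `{e.j,f.j}`,
`{g.j,e.j}`, `{f.j,h.j}` for `1 ≤ j ≤ k`, and `{f.j,e.(j+1)}` for `1 ≤ j ≤ k-1`. -/
def gbase (k : ℕ) : GVert k → GVert k → Prop
  | .R, .h0 => True
  | .h0, .f0 => True
  | .f0, .e j => (j : ℕ) = 0
  | .e j, .f j' => j = j'
  | .g j, .e j' => j = j'
  | .f j, .h j' => j = j'
  | .f j, .e j' => (j' : ℕ) = (j : ℕ) + 1
  | _, _ => False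

/-- The graph `𝒢_k` extended with `y` additional vertices adjacent only to `R`. -/
def GGraphExt (k y : ℕ) : SimpleGraph (GVert k ⊕ Fin y) :=
  SimpleGraph.fromRel (fun a b =>
    match a, b with
    | Sum.inl u, Sum.inl v => gbase k u v
    | Sum.inl GVert.R, Sum.inr _ => True
    | _, _ => False)

section Moves

variable {V : Type*} {G : SimpleGraph V} {r : V} {D : ℕ}

/-- In the distance assignment `d`, the non-root vertex `p` may be given the value `v ≤ D`,
which is one more than the minimum of `d` over the neighbors of `p`. -/
def Fires (G : SimpleGraph V) (r : V) (D : ℕ) (d : V → ℕ) (p : V) (v : ℕ) : Prop :=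
  p ≠ r ∧ v ≤ D ∧ ∃ q, G.Adj p q ∧ v = d q + 1 ∧ ∀ q', G.Adj p q' → d q ≤ d q'

/-- A nontrivial simultaneous correction of distances. -/
def Move (G : SimpleGraph V) (r : V) (D : ℕ) (d d' : V → ℕ) : Prop :=
  (∃ p, d' p ≠ d p) ∧ ∀ p, d' p ≠ d p → Fires G r D d p (d' p)

/-- `d'` is reached from `d` by exactly `n` moves. -/
inductive Moves (G : SimpleGraph V) (r : V) (D : ℕ) : ℕ → (V → ℕ) → (V → ℕ) → Prop
  | refl (d : V → ℕ) : Moves G r D 0 d d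
  | head {n : ℕ} {d d' d'' : V → ℕ} : Move G r D d d' → Moves G r D n d' d'' →
      Moves G r D (n + 1) d d''

theorem Moves.trans {m n : ℕ} {d d' d'' : V → ℕ} (h : Moves G r D m d d')
    (h' : Moves G r D n d' d'') : Moves G r D (m + n) d d'' := by
  induction h with
  | refl => simpa using h'
  | head hm _ ih => rw [Nat.add_right_comm]; exact .head hm (ih h')

theorem Moves.of_eq {d d' : V → ℕ} (h : d = d') : Moves G r D 0 d d' :=
  h ▸ .refl d

theorem Moves.trans_eq {n : ℕ} {d d' d'' : V → ℕ} (h : Moves G r D n d d') (h' : d' = d'') :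
    Moves G r D n d d'' :=
  h' ▸ h

theorem Fires.move [DecidableEq V] {d : V → ℕ} {p : V} {v : ℕ} (h : Fires G r D d p v)
    (hv : v ≠ d p) : Move G r D d (Function.update d p v) := by
  refine ⟨⟨p, by simpa using hv⟩, fun x hx => ?_⟩
  by_cases hxp : x = p
  · subst hxp; simpa using h
  · simp [hxp] at hx

theorem Fires.move_two [DecidableEq V] {d : V → ℕ} {p q : V} {v w : ℕ} (hp : Fires G r D d p v)
    (hq : Fires G r D d q w) (hw : w ≠ d q) :
    Move G r D d (Function.update (Function.update d p v) q w) := by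
  refine ⟨⟨q, by simpa using hw⟩, fun x hx => ?_⟩
  by_cases hxq : x = q
  · subst hxq; simpa using hq
  by_cases hxp : x = p
  · subst hxp; simpa [hxq] using hp
  · simp [hxp, hxq] at hx

theorem Fires.move_three [DecidableEq V] {d : V → ℕ} {p q s : V} {v w u : ℕ}
    (hp : Fires G r D d p v) (hq : Fires G r D d q w) (hs : Fires G r D d s u) (hu : u ≠ d s) :
    Move G r D d (Function.update (Function.update (Function.update d p v) q w) s u) := by
  refine ⟨⟨s, by simpa using hu⟩, fun x hx => ?_⟩
  by_cases hxs : x = s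
  · subst hxs; simpa using hs
  by_cases hxq : x = q
  · subst hxq; simpa [hxs] using hq
  by_cases hxp : x = p
  · subst hxp; simpa [hxs, hxq] using hp
  · simp [hxp, hxq, hxs] at hx

theorem minD_eq {γ : Config V} {p q : V} (hq : G.Adj p q)
    (hmin : ∀ q', G.Adj p q' → γ.d q ≤ γ.d q') : minD G γ p = γ.d q :=
  IsLeast.csInf_eq ⟨⟨q, hq, rfl⟩, by rintro _ ⟨q', hq', rfl⟩; exact hmin q' hq'⟩

theorem ValidB.exists_step {γ : Config V} {d' : V → ℕ} (hγ : ValidB G r D γ)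
    (h : Move G r D γ.d d') :
    ∃ γ' : Config V, γ'.d = d' ∧ ValidB G r D γ' ∧ Step r (execB G D) γ γ' ∧
      Step r (execFHC G D) γ γ' := by
  classical
  obtain ⟨⟨p₀, hp₀⟩, hF⟩ := h
  have key : ∀ p, ∃ t, (d' p = γ.d p → t = γ.par p) ∧
      (d' p ≠ γ.d p → G.Adj p t ∧ γ.d t = minD G γ p ∧ d' p = minD G γ p + 1 ∧
        (t = γ.par p ∨ minD G γ p < γ.d (γ.par p))) := by
    intro p
    by_cases hp : d' p = γ.d p
    · exact ⟨γ.par p, fun _ => rfl, fun h => absurd hp h⟩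
    obtain ⟨hpr, -, q, hq, hv, hmin⟩ := hF p hp
    have hpar := (hγ.2 p hpr).1
    have hm := minD_eq hq hmin
    rcases (hmin _ hpar).eq_or_lt with heq | hlt
    · exact ⟨γ.par p, fun _ => rfl, fun _ => ⟨hpar, by omega, by omega, .inl rfl⟩⟩
    · exact ⟨q, fun h => absurd h hp, fun _ => ⟨hq, by omega, by omega, .inr (by omega)⟩⟩
  choose t ht ht' using key
  refine ⟨⟨d', t⟩, rfl, ⟨?_, fun p hp => ?_⟩, ⟨{p | d' p ≠ γ.d p}, ⟨p₀, hp₀⟩, ?_, ?_⟩,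
    ⟨{p | d' p ≠ γ.d p}, ⟨p₀, hp₀⟩, ?_, ?_⟩⟩
  · by_contra hne
    exact (hF r fun h => hne (h.trans hγ.1)).1 rfl
  · by_cases hd : d' p = γ.d p
    · simpa [hd, ht p hd] using hγ.2 p hp
    · have := (hF p hd).2.1
      have h2 := ht' p hd
      exact ⟨h2.1, by simp only; omega, this⟩
  · intro p hp
    have h1 := hF p hp
    obtain ⟨h2, h3, h4, -⟩ := ht' p hp
    have : γ.d p ≠ minD G γ p + 1 := fun h => hp (h4.trans h.symm)
    exact ⟨h1.1, .inl ⟨by have := h1.2.1; omega, this, h4, h2, h3⟩⟩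
  · intro p hp
    have hp : d' p = γ.d p := by simpa using hp
    exact ⟨hp, ht p hp⟩
  · intro p hp
    have h1 := hF p hp
    obtain ⟨h2, h3, h4, h5⟩ := ht' p hp
    refine ⟨h1.1, ?_⟩
    rcases h5 with h5 | h5
    · have : γ.d p ≠ minD G γ p + 1 := fun h => hp (h4.trans h.symm)
      rw [h5] at h3
      exact .inl ⟨by rwa [parOk, h3], by have := h1.2.1; omega, h3, by simp only; omega, h5⟩
    · exact .inr ⟨h5, h4, h2, h3⟩
  · intro p hp
    have hp : d' p = γ.d p := by simpa using hp
    exact ⟨hp, ht p hp⟩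

theorem Moves.exists_execution {n : ℕ} {d d' : V → ℕ} (h : Moves G r D n d d') {γ₀ : Config V}
    (hγ₀ : ValidB G r D γ₀) (hd : γ₀.d = d) :
    ∃ γ : ℕ → Config V, γ 0 = γ₀ ∧ (∀ i ≤ n, ValidB G r D (γ i)) ∧
      (∀ i < n, Step r (execB G D) (γ i) (γ (i + 1))) ∧
      ∀ i < n, Step r (execFHC G D) (γ i) (γ (i + 1)) := by
  induction h generalizing γ₀ with
  | refl => exact ⟨fun _ => γ₀, rfl, fun _ _ => hγ₀, by simp, by simp⟩
  | head hm _ ih =>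
    subst hd
    obtain ⟨γ₁, hd₁, hv, hB, hF⟩ := hγ₀.exists_step hm
    obtain ⟨γ, h0, hval, hsB, hsF⟩ := ih hv hd₁
    refine ⟨fun i => i.casesOn γ₀ γ, rfl, ?_, ?_, ?_⟩
    · rintro (_ | i) hi
      exacts [hγ₀, hval i (by omega)]
    · rintro (_ | i) hi
      exacts [by simpa [h0] using hB, hsB i (by omega)]
    · rintro (_ | i) hi
      exacts [by simpa [h0] using hF, hsF i (by omega)]

end Moves

namespace GGraphExt

variable {k y D : ℕ}

/-- The neighbor of `e.j` preceding it on the path from the root. -/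
def pred (j : Fin k) : GVert k :=
  if h : (j : ℕ) = 0 then .f0 else .f ⟨j - 1, by omega⟩

theorem pred_of_succ {j j' : Fin k} (h : (j' : ℕ) = j + 1) : pred j' = .f j := by
  unfold pred
  split_ifs with h0
  · omega
  · congr 1; ext; simp [h]

theorem pred_cases (j : Fin k) : pred j = .f0 ∨ ∃ i < j, pred j = .f i := by
  unfold pred
  split_ifs with h0
  · exact .inl rfl
  · exact .inr ⟨_, by rw [Fin.lt_def]; simp; omega, rfl⟩

theorem adj_h0 (q : GVert k ⊕ Fin y) :
    (GGraphExt k y).Adj (.inl .h0) q ↔ q = .inl .R ∨ q = .inl .f0 := by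
  rcases q with (_ | _ | _ | _ | _ | _ | _) | _ <;> simp [GGraphExt, gbase]

theorem adj_g (j : Fin k) (q : GVert k ⊕ Fin y) :
    (GGraphExt k y).Adj (.inl (.g j)) q ↔ q = .inl (.e j) := by
  rcases q with (_ | _ | _ | _ | _ | _ | _) | _ <;> simp [GGraphExt, gbase, eq_comm]

theorem adj_h (j : Fin k) (q : GVert k ⊕ Fin y) :
    (GGraphExt k y).Adj (.inl (.h j)) q ↔ q = .inl (.f j) := by
  rcases q with (_ | _ | _ | _ | _ | _ | _) | _ <;> simp [GGraphExt, gbase]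

theorem adj_e (j : Fin k) (q : GVert k ⊕ Fin y) :
    (GGraphExt k y).Adj (.inl (.e j)) q ↔
      q = .inl (pred j) ∨ q = .inl (.f j) ∨ q = .inl (.g j) := by
  unfold pred
  rcases q with (_ | _ | _ | _ | i | _ | _) | _ <;> split_ifs with h0 <;>
    simp [GGraphExt, gbase, h0, eq_comm, Fin.ext_iff]
  omega

theorem adj_f (j : Fin k) (q : GVert k ⊕ Fin y) :
    (GGraphExt k y).Adj (.inl (.f j)) q ↔
      q = .inl (.e j) ∨ q = .inl (.h j) ∨ ∃ i : Fin k, (i : ℕ) = j + 1 ∧ q = .inl (.e i) := by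
  rcases q with (_ | _ | _ | i | _ | _ | _) | _ <;>
    simp [GGraphExt, gbase, eq_comm]
  exact or_comm

variable {d : GVert k ⊕ Fin y → ℕ} {v : ℕ} {j : Fin k}

theorem fires_g (h : v = d (.inl (.e j)) + 1) (hv : v ≤ D) :
    Fires (GGraphExt k y) (.inl .R) D d (.inl (.g j)) v :=
  ⟨by simp, hv, _, (adj_g j _).2 rfl, h, fun q hq => by rw [(adj_g j q).1 hq]⟩

theorem fires_h (h : v = d (.inl (.f j)) + 1) (hv : v ≤ D) :
    Fires (GGraphExt k y) (.inl .R) D d (.inl (.h j)) v :=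
  ⟨by simp, hv, _, (adj_h j _).2 rfl, h, fun q hq => by rw [(adj_h j q).1 hq]⟩

theorem fires_e (hv : v ≤ D) (hpred : v ≤ d (.inl (pred j)) + 1) (hf : v ≤ d (.inl (.f j)) + 1)
    (hg : v ≤ d (.inl (.g j)) + 1)
    (h : v = d (.inl (pred j)) + 1 ∨ v = d (.inl (.f j)) + 1 ∨ v = d (.inl (.g j)) + 1) :
    Fires (GGraphExt k y) (.inl .R) D d (.inl (.e j)) v := by
  have hmin : ∀ q, (GGraphExt k y).Adj (.inl (.e j)) q → v ≤ d q + 1 := by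
    intro q hq
    rcases (adj_e j q).1 hq with rfl | rfl | rfl <;> assumption
  have hex : ∃ q, (GGraphExt k y).Adj (.inl (.e j)) q ∧ v = d q + 1 := by
    rcases h with h | h | h
    exacts [⟨_, (adj_e j _).2 (.inl rfl), h⟩, ⟨_, (adj_e j _).2 (.inr (.inl rfl)), h⟩,
      ⟨_, (adj_e j _).2 (.inr (.inr rfl)), h⟩]
  obtain ⟨q, hq, hvq⟩ := hex
  exact ⟨by simp, hv, q, hq, hvq, fun q' hq' => by have := hmin q' hq'; omega⟩

theorem fires_f (hv : v ≤ D) (he : v ≤ d (.inl (.e j)) + 1) (hh : v ≤ d (.inl (.h j)) + 1)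
    (hsucc : ∀ i : Fin k, (i : ℕ) = j + 1 → v ≤ d (.inl (.e i)) + 1)
    (h : v = d (.inl (.e j)) + 1 ∨ v = d (.inl (.h j)) + 1 ∨
      ∃ i : Fin k, (i : ℕ) = j + 1 ∧ v = d (.inl (.e i)) + 1) :
    Fires (GGraphExt k y) (.inl .R) D d (.inl (.f j)) v := by
  have hmin : ∀ q, (GGraphExt k y).Adj (.inl (.f j)) q → v ≤ d q + 1 := by
    intro q hq
    rcases (adj_f j q).1 hq with rfl | rfl | ⟨i, hi, rfl⟩
    exacts [he, hh, hsucc i hi]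
  have hex : ∃ q, (GGraphExt k y).Adj (.inl (.f j)) q ∧ v = d q + 1 := by
    rcases h with h | h | ⟨i, hi, h⟩
    exacts [⟨_, (adj_f j _).2 (.inl rfl), h⟩, ⟨_, (adj_f j _).2 (.inr (.inl rfl)), h⟩,
      ⟨_, (adj_f j _).2 (.inr (.inr ⟨i, hi, rfl⟩)), h⟩]
  obtain ⟨q, hq, hvq⟩ := hex
  exact ⟨by simp, hv, q, hq, hvq, fun q' hq' => by have := hmin q' hq'; omega⟩

/-- The background values at level `i`. -/
def Canonical (D : ℕ) (d : GVert k ⊕ Fin y → ℕ) (i : Fin k) : Prop :=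
  d (.inl (.e i)) = D - 2 ∧ d (.inl (.g i)) = D - 1 ∧ d (.inl (.f i)) = D - 3 ∧
    d (.inl (.h i)) = D

/-- Raising the value at `e.j` from `D - 4 - 2 * s` to `D - 2` takes `n` moves when
the levels beyond `j` are canonical. -/
def RaiseE (k y D s n : ℕ) : Prop :=
  ∀ (j : Fin k) (d : GVert k ⊕ Fin y → ℕ), j + s < k → d (.inl (.e j)) = D - 4 - 2 * s →
    d (.inl (.g j)) = D - 1 → d (.inl (.f j)) = D - 3 → d (.inl (.h j)) = D →
    D - 3 ≤ d (.inl (pred j)) → (∀ i, j < i → Canonical D d i) →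
    Moves (GGraphExt k y) (.inl .R) D n d (Function.update d (.inl (.e j)) (D - 2))

/-- Raising the value at `f.j` from `D - 5 - 2 * s` to `D - 3` takes `n` moves when
the levels beyond `j` are canonical. -/
def RaiseF (k y D s n : ℕ) : Prop :=
  ∀ (j : Fin k) (d : GVert k ⊕ Fin y → ℕ), j + s + 1 < k → d (.inl (.f j)) = D - 5 - 2 * s →
    d (.inl (.e j)) = D - 2 → d (.inl (.h j)) = D → (∀ i, j < i → Canonical D d i) →
    Moves (GGraphExt k y) (.inl .R) D n d (Function.update d (.inl (.f j)) (D - 3))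

theorem pred_ne_f (j : Fin k) {i : Fin k} (h : j ≤ i) : pred j ≠ .f i := by
  rcases pred_cases j with h' | ⟨l, hl, h'⟩
  · simp [h']
  · simp [h', (hl.trans_le h).ne]

theorem pred_ne_e (i j : Fin k) : pred j ≠ .e i := by
  unfold pred; split_ifs <;> simp

theorem pred_ne_g (i j : Fin k) : pred j ≠ .g i := by
  unfold pred; split_ifs <;> simp

theorem raiseE_zero (hD : 2 * k + 3 ≤ D) : RaiseE k y D 0 3 := by
  intro j d hj he hg hf hh hp _
  have hk := j.isLt
  have hpf := pred_ne_f j le_rfl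
  have hpe := pred_ne_e j j
  have hpg := pred_ne_g j j
  refine .head ((fires_g (j := j) (v := D - 3) ?_ ?_).move ?_)
    (.head ((fires_e (j := j) (v := D - 2) ?_ ?_ ?_ ?_ ?_).move ?_)
    (.head ((fires_g (j := j) (v := D - 1) ?_ ?_).move ?_) (.of_eq ?final)))
  case final => ext q; simp only [Function.update_apply]; grind
  all_goals simp [*]
  all_goals omega

theorem raiseF_zero (hD : 2 * k + 3 ≤ D) : RaiseF k y D 0 9 := by
  intro j d hj hf he hh hc
  obtain ⟨j', hj'⟩ : ∃ j' : Fin k, (j' : ℕ) = j + 1 := ⟨⟨j + 1, by omega⟩, rfl⟩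
  have hlt : j < j' := by rw [Fin.lt_def]; omega
  have hne := hlt.ne
  have hne' := hlt.ne'
  obtain ⟨he', hg', hf', hh'⟩ := hc j' hlt
  have hp := pred_of_succ hj'
  have huniq : ∀ i : Fin k, (i : ℕ) = j + 1 → i = j' := fun i hi => Fin.ext (by omega)
  have hsucc : ∀ i : Fin k, (i : ℕ) = j' + 1 → i ≠ j' ∧ i ≠ j ∧ d (.inl (.e i)) = D - 2 :=
    fun i hi => ⟨by rintro rfl; omega, by rintro rfl; omega,
      (hc i (by rw [Fin.lt_def]; omega)).1⟩
  refine .head ((fires_h (j := j') (v := D - 2) ?_ ?_).move ?_)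
    (.head ((fires_f (j := j') (v := D - 1) ?_ ?_ ?_ (fun i hi => ?_) (.inl ?_)).move ?_)
    (.head ((fires_h (j := j') (v := D) ?_ ?_).move ?_)
    (.head ((fires_e (j := j') (v := D - 4) ?_ ?_ ?_ ?_ (.inl ?_)).move ?_)
    (.head ((fires_g (j := j') (v := D - 3) ?_ ?_).move ?_)
    (.head ((fires_f (j := j') (v := D - 3) ?_ ?_ ?_ (fun i hi => ?_) (.inl ?_)).move ?_)
    (.head ((fires_f (j := j) (v := D - 3) ?_ ?_ ?_ (fun i hi => ?_)
      (.inr (.inr ⟨j', hj', ?_⟩))).move ?_)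
    (.head ((fires_e (j := j') (v := D - 2) ?_ ?_ ?_ ?_ (.inl ?_)).move ?_)
    (.head ((fires_g (j := j') (v := D - 1) ?_ ?_).move ?_) (.of_eq ?final)))))))))
  case final => ext q; simp only [Function.update_apply]; grind
  all_goals try have h1 := hsucc _ ‹_›
  all_goals try have h1 := huniq _ ‹_›
  all_goals simp [*]
  all_goals try omega

theorem raiseE_succ {s a b : ℕ} (hD : 2 * k + 3 ≤ D) (hE : RaiseE k y D s a)
    (hF : RaiseF k y D s b) : RaiseE k y D (s + 1) (b + (a + 1) + 1) := by
  intro j d hj he hg hf hh hp hc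
  have hpf := pred_ne_f j le_rfl
  have hpe := pred_ne_e j j
  have hpg := pred_ne_g j j
  have hsucc : ∀ i : Fin k, (i : ℕ) = j + 1 → d (.inl (.e i)) = D - 2 :=
    fun i hi => (hc i (by rw [Fin.lt_def]; omega)).1
  have hc' : ∀ i, j < i → i ≠ j ∧ d (.inl (.e i)) = D - 2 ∧ d (.inl (.g i)) = D - 1 ∧
      d (.inl (.f i)) = D - 3 ∧ d (.inl (.h i)) = D := fun i hi => ⟨hi.ne', hc i hi⟩
  have key := (hF j (Function.update (Function.update (Function.update d (.inl (.e j)) (D - 2))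
      (.inl (.g j)) (D - 5 - 2 * s)) (.inl (.f j)) (D - 5 - 2 * s))
      (by omega) ?_ ?_ ?_ (fun i hi => ?_)).trans
    (.head ((fires_e (j := j) (v := D - 4 - 2 * s) ?_ ?_ ?_ ?_ (.inr (.inr ?_))).move_two
      (fires_g (j := j) (v := D - 1) ?_ ?_) ?_)
    (hE j _ (by omega) ?_ ?_ ?_ ?_ ?_ (fun i hi => ?_)))
  · refine .head ((fires_e (j := j) (v := D - 2) ?_ ?_ ?_ ?_ (.inr (.inl ?_))).move_three
      (fires_g (j := j) (v := D - 5 - 2 * s) ?_ ?_)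
      (fires_f (j := j) (v := D - 5 - 2 * s) ?_ ?_ ?_ (fun i hi => ?_) (.inl ?_)) ?_) (key.trans_eq ?final)
    case final => ext q; simp only [Function.update_apply]; grind
    all_goals try have h1 := hsucc _ ‹_›
    all_goals simp [*]
    all_goals omega
  all_goals try have h1 := hc' _ ‹_›
  all_goals simp [Canonical, *]
  all_goals omega

theorem raiseF_succ {s a b : ℕ} (hD : 2 * k + 3 ≤ D) (hE : RaiseE k y D (s + 1) a)
    (hF : RaiseF k y D s b) : RaiseF k y D (s + 1) (a + (b + 1) + 1) := by
  intro j d hj hf he hh hc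
  obtain ⟨j', hj'⟩ : ∃ j' : Fin k, (j' : ℕ) = j + 1 := ⟨⟨j + 1, by omega⟩, rfl⟩
  have hlt : j < j' := by rw [Fin.lt_def]; omega
  have hne := hlt.ne
  have hne' := hlt.ne'
  obtain ⟨he', hg', hf', hh'⟩ := hc j' hlt
  have hp := pred_of_succ hj'
  have huniq : ∀ i : Fin k, (i : ℕ) = j + 1 → i = j' := fun i hi => Fin.ext (by omega)
  have hc' : ∀ i, j' < i → i ≠ j' ∧ i ≠ j ∧ d (.inl (.e i)) = D - 2 ∧ d (.inl (.g i)) = D - 1 ∧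
      d (.inl (.f i)) = D - 3 ∧ d (.inl (.h i)) = D :=
    fun i hi => ⟨hi.ne', (hlt.trans hi).ne', hc i (hlt.trans hi)⟩
  have hc'' : ∀ i, j < i → i ≠ j ∧ d (.inl (.e i)) = D - 2 ∧ d (.inl (.g i)) = D - 1 ∧
      d (.inl (.f i)) = D - 3 ∧ d (.inl (.h i)) = D := fun i hi => ⟨hi.ne', hc i hi⟩
  have key := (hE j' (Function.update (Function.update (Function.update d (.inl (.f j)) (D - 1))
      (.inl (.h j)) (D - 6 - 2 * s)) (.inl (.e j')) (D - 6 - 2 * s))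
      (by omega) ?_ ?_ ?_ ?_ ?_ (fun i hi => ?_)).trans
    (.head ((fires_f (j := j) (v := D - 5 - 2 * s) ?_ ?_ ?_ (fun i hi => ?_) (.inr (.inl ?_))).move_two
      (fires_h (j := j) (v := D) ?_ ?_) ?_)
    (hF j _ (by omega) ?_ ?_ ?_ (fun i hi => ?_)))
  · refine .head ((fires_f (j := j) (v := D - 1) ?_ ?_ ?_ (fun i hi => ?_) (.inl ?_)).move_three
      (fires_h (j := j) (v := D - 6 - 2 * s) ?_ ?_)
      (fires_e (j := j') (v := D - 6 - 2 * s) ?_ ?_ ?_ ?_ (.inl ?_)) ?_) (key.trans_eq ?final)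
    case final => ext q; simp only [Function.update_apply]; grind
    all_goals try have h1 := huniq _ ‹_›
    all_goals simp [*]
    all_goals omega
  case refine_18 =>
    have h1 := hc'' i hi
    by_cases hij : i = j' <;> simp [Canonical, *]
  all_goals try have h1 := huniq _ ‹_›
  all_goals try have h1 := hc' _ ‹_›
  all_goals simp [Canonical, *]
  all_goals omega
/-- Lengths of the executions raising the value at `e.j` and at `f.j`, respectively. -/
def raiseLength : ℕ → ℕ × ℕ
  | 0 => (3, 9)
  | s + 1 =>
    let a := (raiseLength s).2 + ((raiseLength s).1 + 1) + 1
    (a, a + ((raiseLength s).2 + 1) + 1)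

theorem raise (hD : 2 * k + 3 ≤ D) (s : ℕ) :
    RaiseE k y D s (raiseLength s).1 ∧ RaiseF k y D s (raiseLength s).2 := by
  induction s with
  | zero => exact ⟨raiseE_zero hD, raiseF_zero hD⟩
  | succ s ih =>
    have h := raiseE_succ hD ih.1 ih.2
    exact ⟨h, raiseF_succ hD h ih.2⟩

theorem le_raiseLength (s : ℕ) :
    (2 * (s + 1) + 6) * 2 ^ (s + 1) ≤ (raiseLength (s + 1)).1 + 2 ∧
      (2 * (s + 1) + 10) * 2 ^ (s + 1) ≤ (raiseLength (s + 1)).2 + 2 := by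
  induction s with
  | zero => decide
  | succ s ih =>
    rw [raiseLength, pow_succ 2 (s + 1)]
    have := Nat.zero_le (s * 2 ^ (s + 1))
    constructor <;> simp only <;> nlinarith

theorem le_sum_raiseLength (s : ℕ) :
    (2 * (s + 1) + 2) * 2 ^ (s + 1) ≤
      ∑ i ∈ Finset.range (s + 1), (raiseLength i).1 + 1 + (2 * (s + 1) + 2) := by
  induction s with
  | zero => decide
  | succ s ih =>
    rw [Finset.sum_range_succ, pow_succ 2 (s + 1)]
    have := (le_raiseLength s).1
    linarith

/-- The distances after the values at the last `t` of the vertices `e.j` have been raised. -/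
def stage (k y D t : ℕ) : GVert k ⊕ Fin y → ℕ
  | .inl .R => 0
  | .inl .h0 => 1
  | .inl .f0 => D - 1
  | .inl (.e j) => if k ≤ j + t then D - 2 else D - 4 - 2 * (k - 1 - j)
  | .inl (.g _) => D - 1
  | .inl (.f _) => D - 3
  | .inl (.h _) => D
  | .inr _ => 1

theorem moves_stage (hD : 2 * k + 3 ≤ D) {t : ℕ} (ht : t ≤ k) :
    Moves (GGraphExt k y) (.inl .R) D (∑ s ∈ Finset.range t, (raiseLength s).1)
      (stage k y D 0) (stage k y D t) := by
  induction t with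
  | zero => exact .refl _
  | succ t ih =>
    rw [Finset.sum_range_succ]
    refine (ih (by omega)).trans (((raise hD t).1 ⟨k - 1 - t, by omega⟩ _ ?_ ?_ rfl rfl rfl ?_
      fun i hi => ⟨?_, rfl, rfl, rfl⟩).trans_eq ?_)
    · simp only; omega
    · simp only [stage]; split_ifs <;> omega
    · rcases pred_cases (⟨k - 1 - t, by omega⟩ : Fin k) with h | ⟨i, -, h⟩ <;>
        simp only [h, stage] <;> omega
    · rw [Fin.lt_def] at hi
      exact if_pos (by simp only at hi; omega)
    · ext q
      rcases q with (_ | _ | _ | j | _ | _ | _) | _ <;>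
        simp only [Function.update_apply, stage, Sum.inl.injEq, GVert.e.injEq, Fin.ext_iff,
          reduceCtorEq, if_false]
      split_ifs <;> omega

/-- The initial distances of the slow execution. -/
def initial (k y D : ℕ) : GVert k ⊕ Fin y → ℕ :=
  Function.update (stage k y D 0) (.inl .h0) D

theorem moves_initial (hD : 2 * k + 3 ≤ D) :
    Moves (GGraphExt k y) (.inl .R) D (∑ s ∈ Finset.range k, (raiseLength s).1 + 1)
      (initial k y D) (stage k y D k) := by
  refine .head ⟨⟨.inl .h0, ?_⟩, fun q hq => ?_⟩ (moves_stage hD le_rfl)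
  · simp only [initial, stage, Function.update_self]; omega
  · have hq : q = .inl .h0 := by
      by_contra hne
      simp [initial, hne] at hq
    subst hq
    exact ⟨by simp, by simp only [stage]; omega, .inl .R, (adj_h0 _).2 (.inl rfl),
      by simp [initial, stage], fun q' _ => by simp [initial, stage]⟩

/-- Arbitrary parent pointers for the initial configuration. -/
def initialPar (k y : ℕ) : GVert k ⊕ Fin y → GVert k ⊕ Fin y
  | .inl .R => .inl .h0
  | .inl .h0 => .inl .R
  | .inl .f0 => .inl .h0
  | .inl (.e j) => .inl (.f j)
  | .inl (.g j) => .inl (.e j)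
  | .inl (.f j) => .inl (.e j)
  | .inl (.h j) => .inl (.f j)
  | .inr _ => .inl .R

theorem validB_initial (hD : 2 * k + 3 ≤ D) :
    ValidB (GGraphExt k y) (.inl .R) D ⟨initial k y D, initialPar k y⟩ := by
  refine ⟨rfl, fun q hq => ?_⟩
  rcases q with (_ | _ | _ | j | j | j | j) | _ <;> try have := j.isLt
  all_goals simp [initial, initialPar, stage, GGraphExt, gbase] at hq ⊢
  all_goals try split_ifs
  all_goals omega

theorem exists_execution (hD : 2 * k + 3 ≤ D) (hk : 1 ≤ k) :
    ∃ (m : ℕ) (γ : ℕ → Config (GVert k ⊕ Fin y)),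
      (2 * k + 2) * (2 ^ k - 1) ≤ m ∧
      (∀ i ≤ m, ValidB (GGraphExt k y) (.inl .R) D (γ i)) ∧
      (∀ i < m, Step (.inl .R) (execB (GGraphExt k y) D) (γ i) (γ (i + 1))) ∧
      ∀ i < m, Step (.inl .R) (execFHC (GGraphExt k y) D) (γ i) (γ (i + 1)) := by
  obtain ⟨γ, -, h⟩ := (moves_initial hD).exists_execution (validB_initial (y := y) hD) rfl
  refine ⟨_, γ, ?_, h⟩
  obtain ⟨s, rfl⟩ := Nat.exists_eq_add_of_le' hk
  have := le_sum_raiseLength s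
  rw [Nat.mul_sub, mul_one]
  omega

theorem card_vert (k y : ℕ) : Fintype.card (GVert k ⊕ Fin y) = 4 * k + 3 + y := by
  let φ : GVert k ≃ Fin 3 ⊕ Fin 4 × Fin k :=
    { toFun := fun
        | .R => .inl 0
        | .h0 => .inl 1
        | .f0 => .inl 2
        | .e j => .inr (0, j)
        | .f j => .inr (1, j)
        | .g j => .inr (2, j)
        | .h j => .inr (3, j)
      invFun := fun
        | .inl 0 => .R
        | .inl 1 => .h0
        | .inl 2 => .f0
        | .inr (0, j) => .e j
        | .inr (1, j) => .f j
        | .inr (2, j) => .g j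
        | .inr (3, j) => .h j
      left_inv := by rintro (_ | _ | _ | _ | _ | _ | _) <;> rfl
      right_inv := by rintro (i | ⟨i, j⟩) <;> fin_cases i <;> rfl }
  rw [Fintype.card_sum, Fintype.card_congr φ]
  simp
  omega

/-- The vertices on the path from `R` to `f.k`. -/
def spine (k : ℕ) : ℕ → GVert k
  | 0 => .R
  | 1 => .h0
  | 2 => .f0
  | n + 3 =>
    if h : n / 2 < k then if n % 2 = 0 then .e ⟨n / 2, h⟩ else .f ⟨n / 2, h⟩ else .R

theorem spine_e (j : Fin k) : spine k (2 * j + 3) = .e j := by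
  simp [spine]

theorem spine_f (j : Fin k) : spine k (2 * j + 4) = .f j := by
  have h : (2 * (j : ℕ) + 1) / 2 = j := by omega
  have h' : (2 * (j : ℕ) + 1) % 2 = 1 := by omega
  simp [spine, h, h']

theorem adj_spine {a : ℕ} (ha : a + 1 ≤ 2 * k + 2) :
    (GGraphExt k y).Adj (.inl (spine k a)) (.inl (spine k (a + 1))) := by
  match a with
  | 0 => simp [GGraphExt, gbase, spine]
  | 1 => simp [GGraphExt, gbase, spine]
  | 2 =>
    have := spine_e (⟨0, by omega⟩ : Fin k)
    simp only [mul_zero, zero_add] at this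
    rw [this]
    simp [GGraphExt, gbase, spine]
  | n + 3 =>
    rcases Nat.even_or_odd' n with ⟨i, rfl | rfl⟩
    · have he := spine_e (⟨i, by omega⟩ : Fin k)
      have hf := spine_f (⟨i, by omega⟩ : Fin k)
      simp only at he hf
      rw [he, hf]
      simp [GGraphExt, gbase]
    · have hf := spine_f (⟨i, by omega⟩ : Fin k)
      have he := spine_e (⟨i + 1, by omega⟩ : Fin k)
      simp only [mul_add, mul_one, add_assoc, Nat.reduceAdd] at he hf ⊢
      rw [he, hf]
      simp [GGraphExt, gbase]

theorem edist_spine_add {a n : ℕ} (h : a + n ≤ 2 * k + 2) :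
    (GGraphExt k y).edist (.inl (spine k a)) (.inl (spine k (a + n))) ≤ n := by
  induction n with
  | zero => simp
  | succ n ih =>
    refine (SimpleGraph.edist_triangle (v := .inl (spine k (a + n)))).trans ?_
    rw [Nat.cast_succ]
    exact add_le_add (ih (by omega))
      (SimpleGraph.edist_eq_one_iff_adj.2 (adj_spine (by omega))).le

theorem edist_spine_le {a b : ℕ} (ha : a ≤ 2 * k + 2) (hb : b ≤ 2 * k + 2) :
    (GGraphExt k y).edist (.inl (spine k a)) (.inl (spine k b)) ≤ (2 * k + 2 : ℕ) := by
  wlog hab : a ≤ b generalizing a b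
  · rw [SimpleGraph.edist_comm]
    exact this hb ha (by omega)
  obtain ⟨n, rfl⟩ := Nat.exists_eq_add_of_le hab
  exact (edist_spine_add hb).trans (by exact_mod_cast (by omega : n ≤ 2 * k + 2))

theorem exists_spine_edist_le (u : GVert k ⊕ Fin y) :
    ∃ a ≤ 2 * k + 2, (GGraphExt k y).edist u (.inl (spine k a)) ≤ 1 := by
  simp only [SimpleGraph.edist_le_one_iff_adj_or_eq]
  rcases u with (_ | _ | _ | j | j | j | j) | i
  · exact ⟨0, by omega, .inr rfl⟩
  · exact ⟨1, by omega, .inr rfl⟩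
  · exact ⟨2, by omega, .inr rfl⟩
  · exact ⟨2 * j + 3, by omega, .inr (by rw [spine_e])⟩
  · exact ⟨2 * j + 4, by omega, .inr (by rw [spine_f])⟩
  · exact ⟨2 * j + 3, by omega, .inl (by rw [spine_e, adj_g])⟩
  · exact ⟨2 * j + 4, by omega, .inl (by rw [spine_f, adj_h])⟩
  · exact ⟨0, by omega, .inl (by simp [GGraphExt, spine])⟩

theorem diam_le (k y : ℕ) : (GGraphExt k y).diam ≤ 2 * k + 4 := by
  refine ENat.toNat_le_of_le_natCast (SimpleGraph.ediam_le_of_edist_le fun u v => ?_)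
  obtain ⟨a, ha, hua⟩ := exists_spine_edist_le u
  obtain ⟨b, hb, hvb⟩ := exists_spine_edist_le v
  rw [SimpleGraph.edist_comm] at hvb
  calc (GGraphExt k y).edist u v ≤ 1 + ((2 * k + 2 : ℕ) + 1) :=
        SimpleGraph.edist_triangle.trans (add_le_add hua
          (SimpleGraph.edist_triangle.trans (add_le_add (edist_spine_le ha hb) hvb)))
    _ = (2 * k + 4 : ℕ) := by norm_cast; omega

end GGraphExt

/-- Let `n ≥ 7` and let `k` be the maximum integer such that `n = 4k+3+y` with
`y ≥ 0`. For every `D ≥ 2k+3`, there exists an `n`-vertex graph of diameter at most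
`2k+4` (namely `𝒢_k` with `y` additional vertices adjacent only to `R`) on which there
is a sequence of configurations `γ_0 ↦ … ↦ γ_m` of `Algo_B(D)` with
`m ≥ (2k+2)(2^k − 1)`; the same holds for `Algo_FHC(D)`. -/
theorem algoB_algoFHC_steps_exponential (n k y D : ℕ) (hn : 7 ≤ n)
    (hny : n = 4 * k + 3 + y)
    (hkmax : ∀ k', (∃ y', n = 4 * k' + 3 + y') → k' ≤ k)
    (hD : 2 * k + 3 ≤ D) :
    Fintype.card (GVert k ⊕ Fin y) = n ∧
    (GGraphExt k y).diam ≤ 2 * k + 4 ∧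
    (∃ (m : ℕ) (γ : ℕ → Config (GVert k ⊕ Fin y)),
      (2 * k + 2) * (2 ^ k - 1) ≤ m ∧
      (∀ i ≤ m, ValidB (GGraphExt k y) (Sum.inl GVert.R) D (γ i)) ∧
      (∀ i < m, Step (Sum.inl GVert.R) (execB (GGraphExt k y) D) (γ i) (γ (i + 1)))) ∧
    (∃ (m : ℕ) (γ : ℕ → Config (GVert k ⊕ Fin y)),
      (2 * k + 2) * (2 ^ k - 1) ≤ m ∧
      (∀ i ≤ m, ValidB (GGraphExt k y) (Sum.inl GVert.R) D (γ i)) ∧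
      (∀ i < m, Step (Sum.inl GVert.R) (execFHC (GGraphExt k y) D) (γ i) (γ (i + 1)))) := by
  have hk : 1 ≤ k := hkmax 1 ⟨n - 7, by omega⟩
  obtain ⟨m, γ, hm, hval, hB, hF⟩ := GGraphExt.exists_execution (y := y) hD hk
  exact ⟨(GGraphExt.card_vert k y).trans hny.symm, GGraphExt.diam_le k y,
    ⟨m, γ, hm, hval, hB⟩, m, γ, hm, hval, hF⟩
end

section
/- Let D ≥ 𝒟 and let γ be a terminal configuration of Algo_HC(D). Then every non-root vertex p satisfies d_p = d_{par_p} + 1 and d_{par_p} = Min_d(p) in γ. -/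
open SimpleGraph

def Legitimate {V : Type*} (G : SimpleGraph V) (r : V) (γ : Config V) : Prop :=
  (∀ p, γ.d p = G.dist p r) ∧ ∀ p, p ≠ r → γ.d p = γ.d (γ.par p) + 1

/-- Terminal configurations of `Algo_U`. -/
def TerminalU {V : Type*} (G : SimpleGraph V) (r : V) (γ : Config V) : Prop :=
  ∀ p, p ≠ r → dOk G γ p ∧ parOk γ p

/-- Terminal configurations of `Algo_B(D)`. -/
def TerminalB {V : Type*} (G : SimpleGraph V) (r : V) (D : ℕ) (γ : Config V) : Prop :=
  ∀ p, p ≠ r →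
    (minD G γ p < D → dOk G γ p ∧ parOk γ p) ∧ (minD G γ p = D → γ.d p = D)

/-- Terminal configurations of `Algo_HC(D)`. -/
def TerminalHC {V : Type*} (G : SimpleGraph V) (r : V) (D : ℕ) (γ : Config V) : Prop :=
  ∀ p, p ≠ r →
    (parOk γ p ∨ D ≤ γ.d (γ.par p)) ∧ γ.d (γ.par p) ≤ minD G γ p

theorem minD_le_of_adj {V : Type*} {G : SimpleGraph V} (γ : Config V) {p q : V}
    (h : G.Adj p q) : minD G γ p ≤ γ.d q :=
  Nat.sInf_le ⟨q, h, rfl⟩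

/-- In a finite connected graph, the parent of a non-root vertex `p` whose neighbor `q` satisfies
`d q ≤ dist q r < dist p r` has value below `D`, so the parent equation holds at `p`. -/
theorem TerminalHC.parOk_of_adj {V : Type*} [Finite V] {G : SimpleGraph V}
    (hconn : G.Connected) {r : V} {D : ℕ} (hD : G.diam ≤ D) {γ : Config V}
    (hterm : TerminalHC G r D γ) {p q : V} (hp : p ≠ r) (hpq : G.Adj p q)
    (hq : γ.d q ≤ G.dist q r) (hlt : G.dist q r < G.dist p r) :
    parOk γ p ∧ γ.d (γ.par p) < G.dist p r := by
  have : Nonempty V := ⟨r⟩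
  have hdiam : G.dist p r ≤ G.diam :=
    dist_le_diam (connected_iff_ediam_ne_top.mp hconn)
  have hmin := minD_le_of_adj γ hpq
  obtain ⟨hpar, hle⟩ := hterm p hp
  exact ⟨hpar.resolve_right (by omega), by omega⟩

theorem exists_adj_dist_lt {V : Type*} {G : SimpleGraph V} (hconn : G.Connected) {p r : V}
    (hp : p ≠ r) : ∃ q, G.Adj p q ∧ G.dist q r < G.dist p r := by
  obtain ⟨w, hw⟩ := hconn.exists_walk_length_eq_dist p r
  cases w with
  | nil => exact absurd rfl hp
  | cons h w =>
    have := dist_le w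
    rw [Walk.length_cons] at hw
    exact ⟨_, h, by omega⟩

theorem TerminalHC.d_le_dist {V : Type*} [Finite V] {G : SimpleGraph V}
    (hconn : G.Connected) {r : V} {D : ℕ} (hD : G.diam ≤ D) {γ : Config V}
    (hroot : γ.d r = 0) (hterm : TerminalHC G r D γ) (p : V) : γ.d p ≤ G.dist p r := by
  induction hk : G.dist p r using Nat.strong_induction_on generalizing p with
  | _ k ih =>
    by_cases hp : p = r
    · simp [hp, hroot]
    · obtain ⟨q, hpq, hlt⟩ := exists_adj_dist_lt hconn hp
      obtain ⟨hpar, hd⟩ :=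
        hterm.parOk_of_adj hconn hD hp hpq (ih _ (hk ▸ hlt) q rfl) hlt
      rw [parOk] at hpar
      omega

/-- Let `D ≥ 𝒟` and let `γ` be a terminal configuration of `Algo_HC(D)`. Then every
non-root vertex `p` satisfies `d p = d (par p) + 1` and `d (par p) = Min_d(p)` in `γ`. -/
theorem terminalHC_parOk_and_min {V : Type*} [Fintype V]
    (G : SimpleGraph V) (hconn : G.Connected) (hcard : 2 ≤ Fintype.card V)
    (r : V) (D : ℕ) (hD : G.diam ≤ D)
    (γ : Config V) (hvalid : ValidB G r D γ) (hterm : TerminalHC G r D γ) :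
    ∀ p, p ≠ r → γ.d p = γ.d (γ.par p) + 1 ∧ γ.d (γ.par p) = minD G γ p := by
  intro p hp
  obtain ⟨q, hpq, hlt⟩ := exists_adj_dist_lt hconn hp
  exact ⟨(hterm.parOk_of_adj hconn hD hp hpq
      (hterm.d_le_dist hconn hD hvalid.1 q) hlt).1,
    le_antisymm (hterm p hp).2 (minD_le_of_adj γ (hvalid.2 p hp).1)⟩
end
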